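/- Weight estimate. There exists a constant C(n) > 0, depending only on n, such that for every degree d ≥ 1 and every ℓ ∈ {0,…,d} with d − ℓ even, the weight w_{n,d}(ℓ) satisfies w_{n,d}(ℓ)² ≤ C(n) · d^{−n/2} · d^{1/2} · 2^{1−d} · binom(d, (d−ℓ)/2). -/

import Mathlib

/-- The volume of the unit `n`-sphere: `vol(S^n) = 2 π^{(n+1)/2} / Γ((n+1)/2)`. -/
noncomputable def volSphere (n : ℕ) : ℝ :=
  2 * Real.pi ^ (((n : ℝ) + 1) / 2) / Real.Gamma (((n : ℝ) + 1) / 2)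

/-- The squared weight `w_{n,d}(ℓ)²` relating the `L²` norm on the sphere and the
Bombieri–Weil norm on the degree-`ℓ` spherical harmonics inside degree-`d` polynomials:
`w_{n,d}(ℓ)² = vol(S^n) · Γ((n+1)/2) · Γ((d+ℓ)/2+1)/Γ((n+1)/2+(d+ℓ)/2) · 2^{-d} · C(d,(d-ℓ)/2)`. -/
noncomputable def wSq (n d ℓ : ℕ) : ℝ :=
  volSphere n * Real.Gamma (((n : ℝ) + 1) / 2) *
    (Real.Gamma (((d : ℝ) + (ℓ : ℝ)) / 2 + 1) /
      Real.Gamma (((n : ℝ) + 1) / 2 + ((d : ℝ) + (ℓ : ℝ)) / 2)) *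
    (2 : ℝ) ^ (-(d : ℝ)) * (d.choose ((d - ℓ) / 2) : ℝ)

/-!
Weight estimate: there is `C(n) > 0` such that for every `d ≥ 1` and `ℓ ∈ {0,…,d}` with
`d - ℓ` even, `w_{n,d}(ℓ)² ≤ C(n) · d^{-n/2} · d^{1/2} · 2^{1-d} · C(d, (d-ℓ)/2)`.
-/

/-- Midpoint log-convexity of the Gamma function. -/
theorem Gamma_add_one_le_sqrt_mul {x : ℝ} (hx : 0 < x) :
    Real.Gamma (x + 1) ≤ (x + 1 / 2) ^ ((1 : ℝ) / 2) * Real.Gamma (x + 1 / 2) := by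
  have hp : 0 < x + 1 / 2 := by linarith
  have hG := Real.Gamma_pos_of_pos hp
  have h := Real.Gamma_mul_add_mul_le_rpow_Gamma_mul_rpow_Gamma (s := x + 1 / 2)
    (t := x + 1 / 2 + 1) (a := 1 / 2) (b := 1 / 2) hp (by linarith)
    (by norm_num) (by norm_num) (by norm_num)
  rw [Real.Gamma_add_one hp.ne', Real.mul_rpow hp.le hG.le, mul_left_comm,
    ← Real.rpow_add hG, add_halves, Real.rpow_one] at h
  convert h using 2
  ring

/-- The ratio `Γ(x+1)/Γ(x+(n+1)/2)` is at most of order `d^{(1-n)/2}` when `d/2 ≤ x ≤ d`. -/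
theorem exists_Gamma_add_one_le_rpow_mul (n : ℕ) :
    ∃ K : ℝ, 0 < K ∧ ∀ d x : ℝ, 1 ≤ d → d / 2 ≤ x → x ≤ d →
      Real.Gamma (x + 1) ≤
        K * d ^ (-(n : ℝ) / 2 + 1 / 2) * Real.Gamma (((n : ℝ) + 1) / 2 + x) := by
  induction n using Nat.twoStepInduction with
  | zero =>
    refine ⟨2 ^ ((1 : ℝ) / 2), by positivity, fun d x hd hdx hxd => ?_⟩
    have hx : 0 < x := by linarith
    refine (Gamma_add_one_le_sqrt_mul hx).trans ?_
    have hG := Real.Gamma_pos_of_pos (show 0 < x + 1 / 2 by linarith)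
    rw [show (-((0 : ℕ) : ℝ) / 2 + 1 / 2) = 1 / 2 by norm_num,
      show (((0 : ℕ) : ℝ) + 1) / 2 + x = x + 1 / 2 by push_cast; ring,
      ← Real.mul_rpow (by norm_num) (by linarith)]
    gcongr
    linarith
  | one =>
    refine ⟨1, one_pos, fun d x _ _ _ => le_of_eq ?_⟩
    rw [show (-((1 : ℕ) : ℝ) / 2 + 1 / 2) = 0 by norm_num,
      show (((1 : ℕ) : ℝ) + 1) / 2 + x = x + 1 by push_cast; ring]
    simp
  | more n ih _ =>
    obtain ⟨K, hK, h⟩ := ih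
    refine ⟨2 * K, by positivity, fun d x hd hdx hxd => (h d x hd hdx hxd).trans ?_⟩
    have hd0 : 0 < d := by linarith
    have hn : (0 : ℝ) ≤ n := n.cast_nonneg
    have hy : 0 < ((n : ℝ) + 1) / 2 + x := by linarith
    have hG := Real.Gamma_pos_of_pos hy
    rw [show (((n + 2 : ℕ) : ℝ) + 1) / 2 + x = ((n : ℝ) + 1) / 2 + x + 1 by push_cast; ring,
      Real.Gamma_add_one hy.ne',
      show -((n : ℝ)) / 2 + 1 / 2 = (-((n + 2 : ℕ) : ℝ) / 2 + 1 / 2) + 1 by push_cast; ring,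
      Real.rpow_add_one hd0.ne']
    have hP : 0 < d ^ (-((n + 2 : ℕ) : ℝ) / 2 + 1 / 2) := Real.rpow_pos_of_pos hd0 _
    calc _ = K * d ^ (-((n + 2 : ℕ) : ℝ) / 2 + 1 / 2) * Real.Gamma (((n : ℝ) + 1) / 2 + x) * d := by
          ring
      _ ≤ K * d ^ (-((n + 2 : ℕ) : ℝ) / 2 + 1 / 2) * Real.Gamma (((n : ℝ) + 1) / 2 + x) *
          (2 * (((n : ℝ) + 1) / 2 + x)) := by
          gcongr
          linarith
      _ = _ := by ring

theorem weight_estimate (n : ℕ) :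
    ∃ C : ℝ, 0 < C ∧ ∀ d ℓ : ℕ, 1 ≤ d → ℓ ≤ d → Even (d - ℓ) →
      wSq n d ℓ ≤ C * (d : ℝ) ^ (-(n : ℝ) / 2) * (d : ℝ) ^ ((1 : ℝ) / 2) *
        (2 : ℝ) ^ (1 - (d : ℝ)) * (d.choose ((d - ℓ) / 2) : ℝ) := by
  obtain ⟨K, hK, h⟩ := exists_Gamma_add_one_le_rpow_mul n
  have hΓ : 0 < Real.Gamma (((n : ℝ) + 1) / 2) := Real.Gamma_pos_of_pos (by positivity)
  have hA : 0 < volSphere n * Real.Gamma (((n : ℝ) + 1) / 2) := by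
    unfold volSphere
    positivity
  refine ⟨volSphere n * Real.Gamma (((n : ℝ) + 1) / 2) * K, by positivity,
    fun d ℓ hd hℓ _ => ?_⟩
  have hd' : (1 : ℝ) ≤ d := by exact_mod_cast hd
  have hℓ' : (ℓ : ℝ) ≤ d := by exact_mod_cast hℓ
  have hℓ0 : (0 : ℝ) ≤ ℓ := ℓ.cast_nonneg
  have hΓ' : 0 < Real.Gamma (((n : ℝ) + 1) / 2 + ((d : ℝ) + ℓ) / 2) :=
    Real.Gamma_pos_of_pos (by positivity)
  have hratio := (div_le_iff₀ hΓ').2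
    (h d (((d : ℝ) + ℓ) / 2) hd' (by linarith) (by linarith))
  rw [Real.rpow_add (by linarith), ← mul_assoc] at hratio
  have hpow : (2 : ℝ) ^ (-(d : ℝ)) ≤ 2 ^ (1 - (d : ℝ)) :=
    Real.rpow_le_rpow_of_exponent_le one_le_two (by linarith)
  unfold wSq
  rw [show ∀ A P Q R B : ℝ, A * K * P * Q * R * B = A * (K * P * Q) * R * B by intros; ring]
  gcongr
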